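/- arXiv:2409.12321 — 2 statements merged into one kernel-verified Lean document; each statement's English description precedes it below -/
import Mathlib

section
/- For all n ≥ 0, a(4n+2) is even, where a(n) counts partitions of n in which each odd part is repeated at most twice. -/
/-- `a n` is the number of partitions of `n` in which each odd part appears at most twice. -/
def a (n : ℕ) : ℕ := Fintype.card {p : n.Partition // ∀ x ∈ p.parts, Odd x → p.parts.count x ≤ 2}

open PowerSeries Finset Filter
open scoped PowerSeries.WithPiTopology

/-- Shanks's finite form of Gauss's identity for the sum of `q ^ t` over triangular numbers `t`. -/
theorem gauss_finite {R : Type*} [CommRing R] (q : R) (n : ℕ) :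
    (∏ k ∈ range n, (1 - q ^ (2 * k + 1))) * ∑ s ∈ range (2 * n), q ^ (∑ k ∈ range (s + 1), k) =
      ∑ s ∈ range n, (∏ k ∈ Ico s n, (1 - q ^ (2 * k + 2))) *
        (∏ k ∈ range s, (1 - q ^ (2 * k + 1))) * q ^ (s * (2 * n + 1)) := by
  induction n with
  | zero => simp
  | succ n ih =>
    have tri (m : ℕ) : ∑ k ∈ range (2 * m + 1), k = m * (2 * m + 1) := by
      induction m with
      | zero => simp
      | succ m ih =>
        rw [show 2 * (m + 1) + 1 = 2 * m + 1 + 1 + 1 by ring, sum_range_succ, sum_range_succ, ih]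
        ring
    have tele (m : ℕ) (hm : m ≤ n) : ∑ s ∈ range m,
        ((∏ k ∈ Ico s (n + 1), (1 - q ^ (2 * k + 2))) *
          (∏ k ∈ range s, (1 - q ^ (2 * k + 1))) * q ^ (s * (2 * (n + 1) + 1)) -
        (1 - q ^ (2 * n + 1)) * ((∏ k ∈ Ico s n, (1 - q ^ (2 * k + 2))) *
          (∏ k ∈ range s, (1 - q ^ (2 * k + 1))) * q ^ (s * (2 * n + 1)))) =
        (1 - q ^ (2 * m)) * (∏ k ∈ Ico m n, (1 - q ^ (2 * k + 2))) *
          (∏ k ∈ range m, (1 - q ^ (2 * k + 1))) * q ^ (m * (2 * n + 1)) := by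
      induction m with
      | zero => simp
      | succ m ih =>
        rw [sum_range_succ, ih (by lia), prod_Ico_succ_top (by lia : m ≤ n),
          prod_eq_prod_Ico_succ_bot (by lia : m < n), prod_range_succ]
        ring
    rw [sum_range_succ, ← sub_eq_iff_eq_add, ← sub_eq_zero]
    have h := tele n le_rfl
    rw [sum_sub_distrib, ← mul_sum, ← ih] at h
    rw [show 2 * (n + 1) = 2 * n + 1 + 1 by ring, sum_range_succ _ (2 * n + 1),
      sum_range_succ _ (2 * n), sum_range_succ _ (2 * n + 1), tri, prod_range_succ] at *
    simp only [Ico_self, prod_empty, prod_Ico_succ_top le_rfl] at *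
    linear_combination -h

/-- An involution on `ℕ × ℕ` which preserves the quadratic form
`x ^ 2 + 3 * y ^ 2` at `x = 2 * i + 1`, `y = 2 * j + 1`. -/
def triangularSwap (p : ℕ × ℕ) : ℕ × ℕ :=
  if p.1 % 2 = p.2 % 2 then
    (((3 * p.2 - p.1 + 1 : ℤ).natAbs - 1) / 2, (p.1 + p.2) / 2)
  else ((3 * p.2 + p.1 + 1) / 2, ((p.1 - p.2 : ℤ).natAbs - 1) / 2)

theorem triangularSwap_involutive : Function.Involutive triangularSwap := by
  rintro ⟨i, j⟩
  simp only [triangularSwap]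
  ext <;> grind

theorem triangularSwap_norm (p : ℕ × ℕ) :
    (triangularSwap p).1 * ((triangularSwap p).1 + 1) +
      3 * ((triangularSwap p).2 * ((triangularSwap p).2 + 1)) =
    p.1 * (p.1 + 1) + 3 * (p.2 * (p.2 + 1)) := by
  obtain ⟨i, j⟩ := p
  simp only [triangularSwap]
  split_ifs with h
  · generalize hv : (i + j) / 2 = v
    generalize hu : ((3 * j - i + 1 : ℤ).natAbs - 1) / 2 = u
    have hi : (i : ℤ) = 2 * v - j := by lia
    have h2 : (u : ℤ) = 2 * j - v ∨ (u : ℤ) = v - 2 * j - 1 := by lia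
    zify
    rcases h2 with h2 | h2 <;> rw [h2, hi] <;> ring
  · generalize hu : (3 * j + i + 1) / 2 = u
    generalize hv : ((i - j : ℤ).natAbs - 1) / 2 = v
    have hi : (i : ℤ) = 2 * u - 3 * j - 1 := by lia
    have h2 : (v : ℤ) = u - 2 * j - 1 ∨ (v : ℤ) = 2 * j - u := by lia
    zify
    rcases h2 with h2 | h2 <;> rw [h2, hi] <;> ring

theorem triangularSwap_ne {p : ℕ × ℕ} {n : ℕ}
    (h : p.1 * (p.1 + 1) + 3 * (p.2 * (p.2 + 1)) = 2 * (4 * n + 2)) : triangularSwap p ≠ p := by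
  obtain ⟨i, j⟩ := p
  intro hp
  simp only [triangularSwap] at hp h
  obtain ⟨k, hk⟩ := Nat.even_mul_succ_self j
  split_ifs at hp with hij <;> rw [Prod.mk.injEq] at hp
  · obtain rfl : i = j := by lia
    lia
  · obtain rfl : i = 3 * j + 1 := by lia
    ring_nf at h hk
    lia

theorem even_card_triangular (n M : ℕ) (hM : 4 * n + 2 < M) :
    Even #{p ∈ range M ×ˢ range M | ∑ k ∈ range (p.1 + 1), k + 3 * ∑ k ∈ range (p.2 + 1), k
      = 4 * n + 2} := by
  have key (p : ℕ × ℕ) : ∑ k ∈ range (p.1 + 1), k + 3 * ∑ k ∈ range (p.2 + 1), k = 4 * n + 2 ↔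
      p.1 * (p.1 + 1) + 3 * (p.2 * (p.2 + 1)) = 2 * (4 * n + 2) := by
    have h1 := sum_range_id_mul_two (p.1 + 1)
    have h2 := sum_range_id_mul_two (p.2 + 1)
    rw [mul_comm, Nat.add_sub_cancel, mul_comm _ p.1] at h1
    rw [mul_comm, Nat.add_sub_cancel, mul_comm _ p.2] at h2
    lia
  simp_rw [key]
  rw [← ZMod.natCast_eq_zero_iff_even, card_eq_sum_ones, Nat.cast_sum]
  refine sum_involution (fun p _ ↦ triangularSwap p) ?_ ?_ ?_ ?_
  · intros; decide
  · exact fun p hp _ ↦ triangularSwap_ne (by simpa using (mem_filter.1 hp).2)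
  · intro p hp
    have h := (mem_filter.1 hp).2
    rw [← triangularSwap_norm] at h
    simp only [mem_filter, mem_product, mem_range]
    refine ⟨⟨?_, ?_⟩, h⟩ <;> nlinarith
  · exact fun p _ ↦ triangularSwap_involutive p

/-- The product `∏ (1 - X ^ (r * i))` over `i ≥ 1`, modulo two. -/
noncomputable def eulerProd (r : ℕ) : (ZMod 2)⟦X⟧ := ∏' i : ℕ, (1 - X ^ (r * (i + 1)))

/-- The product `∏ (1 - X ^ (r * i))` over odd `i`, modulo two. -/
noncomputable def eulerProdOdd (r : ℕ) : (ZMod 2)⟦X⟧ := ∏' i : ℕ, (1 - X ^ (r * (2 * i + 1)))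

/-- The sum of `X ^ (r * t)` over the triangular numbers `t`, modulo two. -/
noncomputable def triangularSeries (r : ℕ) : (ZMod 2)⟦X⟧ :=
  ∑' s : ℕ, X ^ (r * ∑ k ∈ range (s + 1), k)

theorem tendsto_order_X_pow {R : Type*} [CommRing R] [Nontrivial R] {e : ℕ → ℕ}
    (he : ∀ i, i ≤ e i) :
    Tendsto (fun i ↦ ((X : R⟦X⟧) ^ e i).order) atTop (nhds ⊤) := by
  simp_rw [order_X_pow]
  exact ENat.tendsto_natCast_nhds_top.comp (tendsto_atTop_mono he tendsto_id)

theorem multipliable_one_sub_X_pow_of_le {e : ℕ → ℕ} (he : ∀ i, i ≤ e i) :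
    Multipliable fun i ↦ (1 : (ZMod 2)⟦X⟧) - X ^ e i := by
  simp_rw [sub_eq_add_neg]
  apply WithPiTopology.multipliable_one_add_of_tendsto_order_atTop_nhds_top
  simpa only [order_neg] using tendsto_order_X_pow he

theorem hasProd_eulerProd {r : ℕ} (hr : 0 < r) :
    HasProd (fun i ↦ (1 : (ZMod 2)⟦X⟧) - X ^ (r * (i + 1))) (eulerProd r) :=
  (multipliable_one_sub_X_pow_of_le fun i ↦ by nlinarith).hasProd

theorem hasProd_eulerProdOdd {r : ℕ} (hr : 0 < r) :
    HasProd (fun i ↦ (1 : (ZMod 2)⟦X⟧) - X ^ (r * (2 * i + 1))) (eulerProdOdd r) :=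
  (multipliable_one_sub_X_pow_of_le fun i ↦ by nlinarith).hasProd

theorem hasSum_triangularSeries {r : ℕ} (hr : 0 < r) :
    HasSum (fun s ↦ (X : (ZMod 2)⟦X⟧) ^ (r * ∑ k ∈ range (s + 1), k)) (triangularSeries r) := by
  refine (WithPiTopology.summable_of_tendsto_order_atTop_nhds_top _
    (tendsto_order_X_pow fun i ↦ ?_)).hasSum
  rw [sum_range_succ]
  exact (Nat.le_add_left _ _).trans (Nat.le_mul_of_pos_left _ hr)

theorem eulerProd_ne_zero {r : ℕ} (hr : 0 < r) : eulerProd r ≠ 0 := by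
  intro h
  have h0 : constantCoeff (eulerProd r) = 1 := by
    rw [eulerProd, (hasProd_eulerProd hr).multipliable.map_tprod _
      (WithPiTopology.continuous_constantCoeff _)]
    simp [hr.ne']
  simp [h] at h0

theorem eulerProd_two_mul {r : ℕ} (hr : 0 < r) : eulerProd (2 * r) = eulerProd r ^ 2 := by
  have : CharP (ZMod 2)⟦X⟧ 2 := charP_of_injective_ringHom C_injective 2
  rw [pow_two]
  refine (hasProd_eulerProd (by lia)).unique ?_
  convert (hasProd_eulerProd hr).mul (hasProd_eulerProd hr) using 2 with i
  rw [← pow_two, sub_eq_add_neg, sub_eq_add_neg, CharTwo.neg_eq, CharTwo.neg_eq, CharTwo.add_sq]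
  ring

theorem eulerProdOdd_mul_eulerProd {r : ℕ} (hr : 0 < r) :
    eulerProdOdd r * eulerProd (2 * r) = eulerProd r := by
  refine HasProd.unique (HasProd.even_mul_odd (f := fun i ↦ 1 - X ^ (r * (i + 1)))
    (hasProd_eulerProdOdd hr) ?_) (hasProd_eulerProd hr)
  convert hasProd_eulerProd (r := 2 * r) (by lia) using 4
  ring

theorem triangularSeries_mul_eulerProdOdd {r : ℕ} (hr : 0 < r) :
    triangularSeries r * eulerProdOdd r = eulerProd (2 * r) := by
  have h1 := (hasProd_eulerProdOdd hr).tendsto_prod_nat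
  have h2 := (hasSum_triangularSeries hr).tendsto_sum_nat.comp
    (tendsto_id.const_mul_atTop' (r := 2) (by norm_num))
  have h3 := (hasProd_eulerProd (r := 2 * r) (by lia)).tendsto_prod_nat
  have h4 := (h1.mul h2).sub h3
  rw [mul_comm, ← sub_eq_zero]
  refine tendsto_nhds_unique h4 ?_
  rw [WithPiTopology.tendsto_iff_coeff_tendsto]
  refine fun d ↦ tendsto_atTop_of_eventually_const (i₀ := d + 1) fun n hn ↦ ?_
  rw [map_zero]
  refine X_pow_dvd_iff.1 (?_ : X ^ (d + 1) ∣ _) d (by lia)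
  simp only [Function.comp_apply, id_eq]
  have h := gauss_finite ((X : (ZMod 2)⟦X⟧) ^ r) n
  simp_rw [← pow_mul] at h
  rw [h]
  obtain ⟨n, rfl⟩ : ∃ m, n = m + 1 := ⟨n - 1, by lia⟩
  have he : ∏ k ∈ Ico 0 (n + 1), (1 - (X : (ZMod 2)⟦X⟧) ^ (r * (2 * k + 2))) =
      ∏ k ∈ range (n + 1), (1 - X ^ (2 * r * (k + 1))) := by
    rw [range_eq_Ico]
    refine prod_congr rfl fun k _ ↦ ?_
    ring
  rw [sum_range_succ', he, range_zero, prod_empty, zero_mul, mul_zero, pow_zero, mul_one, mul_one,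
    add_sub_cancel_right]
  refine dvd_sum fun s _ ↦ Dvd.dvd.mul_left (pow_dvd_pow _ ?_) _
  nlinarith [Nat.zero_le (s * (2 * (n + 1) + 1)), Nat.le_mul_of_pos_left
    ((s + 1) * (2 * (n + 1) + 1)) hr]

/-- Jacobi's identity for the cube of the Euler product, modulo two. -/
theorem triangularSeries_eq_eulerProd_pow_three {r : ℕ} (hr : 0 < r) :
    triangularSeries r = eulerProd r ^ 3 := by
  apply mul_right_cancel₀ (eulerProd_ne_zero hr)
  nth_rw 1 [← eulerProdOdd_mul_eulerProd hr]
  rw [← mul_assoc, triangularSeries_mul_eulerProdOdd hr, eulerProd_two_mul hr]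
  ring

theorem coeff_triangularSeries_mul (n : ℕ) :
    coeff (4 * n + 2) (triangularSeries 1 * triangularSeries 3) = 0 := by
  have h := ((WithPiTopology.continuous_coeff _ (4 * n + 2)).tendsto _).comp
    ((hasSum_triangularSeries one_pos).tendsto_sum_nat.mul
      (hasSum_triangularSeries three_pos).tendsto_sum_nat)
  refine tendsto_nhds_unique h (tendsto_atTop_of_eventually_const (i₀ := 4 * n + 3) fun M hM ↦ ?_)
  simp only [Function.comp_apply, sum_mul_sum, ← sum_product', ← pow_add, map_sum, coeff_X_pow,
    one_mul, sum_boole, eq_comm (a := 4 * n + 2)]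
  exact ZMod.natCast_eq_zero_iff_even.2 (even_card_triangular n M hM)

theorem genFun_a : PowerSeries.mk (fun n ↦ (a n : ZMod 2)) =
    Nat.Partition.genFun fun i c ↦ if Odd i → c ≤ 2 then (1 : ZMod 2) else 0 := by
  ext n
  rw [coeff_mk, Nat.Partition.coeff_genFun, a, Fintype.card_subtype]
  simp_rw [Finsupp.prod, prod_boole]
  simp

theorem genFun_mul_eulerProd :
    PowerSeries.mk (fun n ↦ (a n : ZMod 2)) * eulerProd 1 = eulerProdOdd 3 := by
  rw [genFun_a]
  refine HasProd.unique ((Nat.Partition.hasProd_genFun _).mul (hasProd_eulerProd one_pos)) ?_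
  rw [← mul_one (eulerProdOdd 3)]
  refine HasProd.even_mul_odd ?_ ?_
  · convert! hasProd_eulerProdOdd three_pos using 2 with i
    rw [tsum_eq_sum (s := range 2)]
    · simp [sum_range_succ]
      ring
    · intro j hj
      simpa using hj
  · convert! hasProd_one using 2 with i
    have h := WithPiTopology.tsum_pow_mul_one_sub_of_constantCoeff_eq_zero
      (f := (X : (ZMod 2)⟦X⟧) ^ (2 * i + 1 + 1)) (by simp)
    have hs : Summable fun j : ℕ ↦ ((X : (ZMod 2)⟦X⟧) ^ (2 * i + 1 + 1)) ^ j :=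
      WithPiTopology.summable_pow_of_constantCoeff_eq_zero (by simp)
    rw [hs.tsum_eq_zero_add] at h
    have : ¬ Odd (2 * i + 1 + 1) := by grind
    simpa [this, ← pow_mul] using h

theorem genFun_mul_eulerProd_mul_eulerProd :
    PowerSeries.mk (fun n ↦ (a n : ZMod 2)) * (eulerProd 1 * eulerProd 3) = 1 := by
  apply mul_right_cancel₀ (eulerProd_ne_zero three_pos)
  rw [← mul_assoc, genFun_mul_eulerProd, mul_assoc, ← pow_two, ← eulerProd_two_mul three_pos,
    eulerProdOdd_mul_eulerProd three_pos, one_mul]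

theorem coeff_pow_four_eq_zero (f : (ZMod 2)⟦X⟧) {m : ℕ} (hm : ¬ 4 ∣ m) : coeff m (f ^ 4) = 0 := by
  have h := MvPowerSeries.map_iterateFrobenius_expand 2 two_ne_zero (f := f) 2
  change PowerSeries.map _ (PowerSeries.expand 4 four_ne_zero f) = f ^ 4 at h
  rw [← h, coeff_map, coeff_expand_of_not_dvd _ _ _ hm, map_zero]

theorem a_four_n_add_two_even (n : ℕ) : Even (a (4 * n + 2)) := by
  set A := PowerSeries.mk (fun n ↦ (a n : ZMod 2)) with hA
  have h : A = A ^ 4 * (triangularSeries 1 * triangularSeries 3) := by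
    rw [triangularSeries_eq_eulerProd_pow_three one_pos,
      triangularSeries_eq_eulerProd_pow_three three_pos]
    calc A = A * (A * (eulerProd 1 * eulerProd 3)) ^ 3 := by
          rw [genFun_mul_eulerProd_mul_eulerProd, one_pow, mul_one]
      _ = _ := by ring
  rw [← ZMod.natCast_eq_zero_iff_even, ← coeff_mk (4 * n + 2) (fun n ↦ (a n : ZMod 2)), ← hA, h,
    coeff_mul]
  refine sum_eq_zero fun p hp ↦ ?_
  rw [HasAntidiagonal.mem_antidiagonal] at hp
  by_cases h4 : 4 ∣ p.1
  · obtain ⟨k, hk⟩ : ∃ k, p.2 = 4 * k + 2 := ⟨p.2 / 4, by lia⟩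
    rw [hk, coeff_triangularSeries_mul, mul_zero]
  · rw [coeff_pow_four_eq_zero _ h4, zero_mul]
end

section
/- For all n ≥ 0, a(4n+3) is even, where a(n) counts partitions of n in which each odd part is repeated at most twice. -/
open Finset PowerSeries Filter Topology
open scoped PowerSeries.WithPiTopology

namespace OddAtMostTwice

/-! ### A finite form of Gauss's triangular number identity -/

section Shanks

variable {R : Type*} [CommRing R] {q : R} {D : ℕ → R}

lemma shanks_telescope (hD : ∀ j, D j * (1 - q ^ (2 * j + 1)) = 1 - q ^ (2 * j + 2))
    {n m : ℕ} (hm : m ≤ n) :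
    (1 - q ^ (2 * n + 1)) * ∑ s ∈ range (m + 1),
      ((∏ j ∈ Ico s (n + 1), D j) * q ^ (s * (2 * n + 3)) -
        (∏ j ∈ Ico s n, D j) * q ^ (s * (2 * n + 1))) =
      (∏ j ∈ Ico m n, D j) * q ^ ((m + 1) * (2 * n + 1)) * (1 - q ^ (2 * m + 1)) := by
  induction m with
  | zero =>
    rw [sum_range_one, prod_Ico_succ_top (Nat.zero_le n)]
    linear_combination (∏ j ∈ Ico 0 n, D j) * hD n
  | succ m ih =>
    rw [sum_range_succ, mul_add, ih (by omega), prod_Ico_succ_top hm,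
      prod_eq_prod_Ico_succ_bot (show m < n by omega)]
    linear_combination
      (∏ j ∈ Ico (m + 1) n, D j) * q ^ ((m + 1) * (2 * n + 1)) * hD m +
      (∏ j ∈ Ico (m + 1) n, D j) * q ^ ((m + 1) * (2 * n + 3)) * hD n

/-- Shanks's finite version of Gauss's identity for triangular numbers. -/
theorem shanks_identity [IsDomain R]
    (hD : ∀ j, D j * (1 - q ^ (2 * j + 1)) = 1 - q ^ (2 * j + 2))
    (hq : ∀ j, 1 - q ^ (2 * j + 1) ≠ 0) (n : ℕ) :
    ∑ s ∈ range n, (∏ j ∈ Ico s n, D j) * q ^ (s * (2 * n + 1)) =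
      ∑ k ∈ range (2 * n), q ^ (k * (k + 1) / 2) := by
  induction n with
  | zero => simp
  | succ n ih =>
    have h := shanks_telescope hD (le_refl n)
    rw [sum_sub_distrib, sum_range_succ (fun s ↦ (∏ j ∈ Ico s n, D j) * q ^ (s * (2 * n + 1))),
      ih, Ico_self, prod_empty, one_mul, one_mul, mul_comm] at h
    have h' := mul_right_cancel₀ (hq n) h
    have e₁ : 2 * n * (2 * n + 1) / 2 = n * (2 * n + 1) := by
      rw [mul_assoc, Nat.mul_div_cancel_left _ two_pos]
    have e₂ : (2 * n + 1) * (2 * n + 1 + 1) / 2 = (n + 1) * (2 * n + 1) := by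
      rw [show (2 * n + 1) * (2 * n + 1 + 1) = 2 * ((n + 1) * (2 * n + 1)) by ring,
        Nat.mul_div_cancel_left _ two_pos]
    rw [show 2 * (n + 1) + 1 = 2 * n + 3 by ring, show 2 * (n + 1) = 2 * n + 1 + 1 by ring,
      sum_range_succ (fun k ↦ q ^ (k * (k + 1) / 2)),
      sum_range_succ (fun k ↦ q ^ (k * (k + 1) / 2)), e₁, e₂]
    linear_combination h'

end Shanks

/-! ### Power series modulo two -/

local instance : TopologicalSpace (ZMod 2) := ⊥
local instance : DiscreteTopology (ZMod 2) := ⟨rfl⟩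

/-- The Euler product `∏ (1 - X ^ (k * i))` over `i ≥ 1`, modulo two. -/
noncomputable def eulerProd (k : ℕ) : (ZMod 2)⟦X⟧ := ∏' i : ℕ, (1 - X ^ (k * (i + 1)))

/-- The series `∑ X ^ (d * (k * (k + 1) / 2))` over `k ≥ 0`, modulo two. -/
noncomputable def triangularSeries (d : ℕ) : (ZMod 2)⟦X⟧ :=
  PowerSeries.mk fun N ↦ coeff N (∑ k ∈ range (N + 1), (X ^ d) ^ (k * (k + 1) / 2))

/-- The generating function of `a`, modulo two. -/
noncomputable def genSeries : (ZMod 2)⟦X⟧ :=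
  Nat.Partition.genFun fun i c ↦ if Odd i → c ≤ 2 then 1 else 0

lemma le_triangle (k : ℕ) : k ≤ k * (k + 1) / 2 := by
  rw [Nat.le_div_iff_mul_le two_pos]
  rcases k with _ | k <;> nlinarith

lemma hasProd_eulerProd {k : ℕ} (hk : 0 < k) :
    HasProd (fun i : ℕ ↦ (1 - X ^ (k * (i + 1)) : (ZMod 2)⟦X⟧)) (eulerProd k) := by
  refine Multipliable.hasProd ?_
  simp_rw [sub_eq_add_neg]
  apply WithPiTopology.multipliable_one_add_of_tendsto_order_atTop_nhds_top
  refine ENat.tendsto_nhds_top_iff_natCast_lt.mpr fun n ↦ eventually_atTop.mpr ⟨n, fun m hm ↦ ?_⟩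
  rw [order_neg, order_X_pow]
  norm_cast
  nlinarith

lemma tendsto_eulerProd {k : ℕ} (hk : 0 < k) :
    Tendsto (fun n ↦ ∏ i ∈ range n, (1 - X ^ (k * (i + 1)) : (ZMod 2)⟦X⟧)) atTop
      (𝓝 (eulerProd k)) :=
  (hasProd_eulerProd hk).tendsto_prod_nat

lemma coeff_eq_of_tendsto {u : ℕ → (ZMod 2)⟦X⟧} {f : (ZMod 2)⟦X⟧} (h : Tendsto u atTop (𝓝 f))
    {N : ℕ} {c : ZMod 2} (hc : ∀ n, coeff N (u n) = c) : coeff N f = c := by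
  have := ((WithPiTopology.tendsto_iff_coeff_tendsto _ _ _ _).mp h) N
  simp only [hc] at this
  exact tendsto_nhds_unique this tendsto_const_nhds

lemma coeff_eulerProd_of_not_dvd {k N : ℕ} (hk : 0 < k) (h : ¬ k ∣ N) :
    coeff N (eulerProd k) = 0 := by
  refine coeff_eq_of_tendsto (tendsto_eulerProd hk) fun n ↦ ?_
  have : ∏ i ∈ range n, (1 - X ^ (k * (i + 1)) : (ZMod 2)⟦X⟧) =
      expand k hk.ne' (∏ i ∈ range n, (1 - X ^ (i + 1))) := by
    simp [map_prod, pow_mul]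
  rw [this, coeff_expand_of_not_dvd _ _ _ h]

lemma coeff_zero_eulerProd {k : ℕ} (hk : 0 < k) : coeff 0 (eulerProd k) = 1 := by
  refine coeff_eq_of_tendsto (tendsto_eulerProd hk) fun n ↦ ?_
  simp [map_prod, hk.ne']

lemma eulerProd_ne_zero {k : ℕ} (hk : 0 < k) : eulerProd k ≠ 0 := by
  intro h
  simpa [h] using coeff_zero_eulerProd hk

lemma eulerProd_sq {k : ℕ} (hk : 0 < k) : eulerProd k ^ 2 = eulerProd (2 * k) := by
  refine tendsto_nhds_unique ((tendsto_eulerProd hk).pow 2) ?_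
  convert tendsto_eulerProd (show 0 < 2 * k by omega) using 2 with n
  rw [← prod_pow]
  refine prod_congr rfl fun i _ ↦ ?_
  have h2 : (2 : (ZMod 2)⟦X⟧) = 0 := by
    rw [← map_ofNat (C (R := ZMod 2)) 2, show (OfNat.ofNat 2 : ZMod 2) = 0 by decide, map_zero]
  linear_combination (X ^ (2 * k * (i + 1)) - X ^ (k * (i + 1))) * h2

lemma coeff_triangularSeries {d N m : ℕ} (hd : 0 < d) (hm : N < m) :
    coeff N (triangularSeries d) = coeff N (∑ k ∈ range m, (X ^ d) ^ (k * (k + 1) / 2)) := by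
  rw [triangularSeries, coeff_mk, map_sum, map_sum]
  refine sum_subset (range_subset_range.mpr hm) fun k _ hk ↦ ?_
  rw [← pow_mul, coeff_X_pow, if_neg]
  have := le_triangle k
  rw [mem_range] at hk
  nlinarith

lemma eulerProd_mul_triangularSeries {d : ℕ} (hd : 0 < d) :
    eulerProd d * triangularSeries d = eulerProd (4 * d) := by
  have hc (m : ℕ) : constantCoeff (1 - (X ^ d) ^ (m + 1) : (ZMod 2)⟦X⟧) ≠ 0 := by
    simp [hd.ne']
  set D : ℕ → (ZMod 2)⟦X⟧ := fun j ↦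
    (1 - (X ^ d) ^ (2 * j + 2)) * (1 - (X ^ d) ^ (2 * j + 1))⁻¹ with hD_def
  have hD (j : ℕ) : D j * (1 - (X ^ d) ^ (2 * j + 1)) = 1 - (X ^ d) ^ (2 * j + 2) := by
    rw [hD_def, mul_assoc, PowerSeries.inv_mul_cancel _ (hc _), mul_one]
  have hS := shanks_identity hD (fun j h ↦ hc (2 * j) (by rw [h, map_zero]))
  have hlim : Tendsto (fun n ↦ ∏ j ∈ range n, D j) atTop (𝓝 (triangularSeries d)) := by
    rw [WithPiTopology.tendsto_iff_coeff_tendsto]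
    refine fun N ↦ tendsto_const_nhds.congr' (eventually_atTop.mpr ⟨N + 1, fun n hn ↦ ?_⟩)
    obtain ⟨n, rfl⟩ := Nat.exists_eq_add_one_of_ne_zero (show n ≠ 0 by omega)
    rw [coeff_triangularSeries hd (show N < 2 * (n + 1) by omega), ← hS, sum_range_succ', map_add,
      map_sum, sum_eq_zero, zero_add, zero_mul, pow_zero, mul_one,
      ← range_eq_Ico]
    intro s _
    rw [← pow_mul, coeff_mul_X_pow', if_neg]
    nlinarith [Nat.zero_le (s * (2 * (n + 1) + 1)),
      Nat.mul_le_mul hd (le_refl ((s + 1) * (2 * (n + 1) + 1)))]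
  have hfin (n : ℕ) : (∏ i ∈ range (2 * n), (1 - X ^ (d * (i + 1)))) * ∏ j ∈ range n, D j =
      (∏ i ∈ range n, (1 - X ^ (2 * d * (i + 1)))) ^ 2 := by
    induction n with
    | zero => simp
    | succ n ih =>
      rw [show 2 * (n + 1) = 2 * n + 1 + 1 by ring, prod_range_succ, prod_range_succ,
        prod_range_succ, prod_range_succ, mul_pow, ← ih]
      have h := hD n
      simp only [← pow_mul] at h
      rw [show 2 * d * (n + 1) = d * (2 * n + 1 + 1) by ring]
      linear_combination (∏ i ∈ range (2 * n), (1 - X ^ (d * (i + 1)))) *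
        (∏ j ∈ range n, D j) * (1 - X ^ (d * (2 * n + 1 + 1))) * h
  have h2 : Tendsto (fun n : ℕ ↦ 2 * n) atTop atTop :=
    tendsto_id.const_mul_atTop' two_pos
  have hl := ((tendsto_eulerProd hd).comp h2).mul hlim
  have hr := (tendsto_eulerProd (show 0 < 2 * d by omega)).pow 2
  simp only [Function.comp_apply, hfin] at hl
  rw [tendsto_nhds_unique hl hr, eulerProd_sq (by omega)]
  ring_nf

/-! ### The generating function of `a` -/

lemma coeff_genSeries (n : ℕ) : coeff n genSeries = (a n : ZMod 2) := by
  rw [genSeries, Nat.Partition.coeff_genFun, a, Fintype.card_subtype, card_filter]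
  simp_rw [Finsupp.prod, prod_boole]
  simp

/-- The factor of `genSeries` recording the multiplicity of the part `i`. -/
noncomputable def partFactor (i : ℕ) : (ZMod 2)⟦X⟧ :=
  1 + ∑' j : ℕ, (if Odd i → j + 1 ≤ 2 then 1 else 0 : ZMod 2) • X ^ (i * (j + 1))

lemma partFactor_mul {i : ℕ} (hi : 0 < i) :
    partFactor i * (1 - X ^ i) = if Odd i then 1 - X ^ (3 * i) else 1 := by
  rw [partFactor]
  split_ifs with h
  · rw [tsum_eq_sum (s := range 2)]
    · simp [sum_range_succ, h]
      ring
    · intro j hj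
      rw [mem_range] at hj
      rw [if_neg (by simp [h]; omega), zero_smul]
  · have hX : constantCoeff (X ^ i : (ZMod 2)⟦X⟧) = 0 := by simp [hi.ne']
    refine Eq.trans ?_ (WithPiTopology.tsum_pow_mul_one_sub_of_constantCoeff_eq_zero hX)
    rw [(WithPiTopology.summable_pow_of_constantCoeff_eq_zero hX).tsum_eq_zero_add]
    simp [h, pow_mul]

lemma hasProd_genSeries : HasProd (fun i ↦ partFactor (i + 1)) genSeries :=
  Nat.Partition.hasProd_genFun fun i c ↦ if Odd i → c ≤ 2 then 1 else 0

lemma genSeries_mul : genSeries * eulerProd 1 * eulerProd 3 = 1 := by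
  have hlim : Tendsto (fun n ↦ ∏ i ∈ range n, partFactor (i + 1)) atTop (𝓝 genSeries) :=
    hasProd_genSeries.tendsto_prod_nat
  have hfin (n : ℕ) : (∏ i ∈ range (2 * n), partFactor (i + 1)) *
      (∏ i ∈ range (2 * n), (1 - X ^ (1 * (i + 1)))) *
      ∏ i ∈ range n, (1 - X ^ (6 * (i + 1))) = ∏ i ∈ range (2 * n), (1 - X ^ (3 * (i + 1))) := by
    induction n with
    | zero => simp
    | succ n ih =>
      have h₁ := partFactor_mul (show 0 < 2 * n + 1 by omega)
      have h₂ := partFactor_mul (show 0 < 2 * n + 1 + 1 by omega)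
      rw [if_pos (by simp)] at h₁
      rw [if_neg (by grind)] at h₂
      rw [show 2 * (n + 1) = 2 * n + 1 + 1 by ring]
      simp only [prod_range_succ, one_mul] at ih ⊢
      rw [← ih, ← h₁, show 3 * (2 * n + 1 + 1) = 6 * (n + 1) by ring]
      linear_combination (∏ i ∈ range (2 * n), partFactor (i + 1)) *
        (∏ i ∈ range (2 * n), (1 - X ^ (i + 1))) *
        (∏ i ∈ range n, (1 - X ^ (6 * (i + 1)))) * (1 - X ^ (6 * (n + 1))) *
        (partFactor (2 * n + 1) * (1 - X ^ (2 * n + 1))) * h₂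
  have h2 : Tendsto (fun n : ℕ ↦ 2 * n) atTop atTop :=
    tendsto_id.const_mul_atTop' two_pos
  have hl := ((hlim.comp h2).mul ((tendsto_eulerProd one_pos).comp h2)).mul
    (tendsto_eulerProd (show 0 < 6 by norm_num))
  simp only [Function.comp_apply, hfin] at hl
  have h := tendsto_nhds_unique hl ((tendsto_eulerProd three_pos).comp h2)
  rw [show 6 = 2 * 3 by norm_num, ← eulerProd_sq three_pos] at h
  refine mul_right_cancel₀ (eulerProd_ne_zero three_pos) ?_
  linear_combination h

lemma genSeries_mul_eulerProd :
    genSeries * (eulerProd 4 * eulerProd 12) = triangularSeries 1 * triangularSeries 3 := by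
  have h₁ := eulerProd_mul_triangularSeries one_pos
  have h₃ := eulerProd_mul_triangularSeries three_pos
  norm_num at h₁ h₃
  rw [← h₁, ← h₃]
  linear_combination triangularSeries 1 * triangularSeries 3 * genSeries_mul

/-! ### Representations by two triangular numbers -/

lemma triangle_eq (k : ℕ) : ((k * (k + 1) / 2 : ℕ) : ℤ) =
    2 * Equiv.intEquivNat.symm k ^ 2 + Equiv.intEquivNat.symm k := by
  obtain ⟨z, rfl⟩ := Equiv.intEquivNat.surjective k
  rw [Equiv.symm_apply_apply]
  rcases z with m | m
  · have : Equiv.intEquivNat (Int.ofNat m) = 2 * m := rfl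
    rw [this, mul_assoc, Nat.mul_div_cancel_left _ two_pos]
    push_cast [Int.ofNat_eq_natCast]
    ring
  · have : Equiv.intEquivNat (Int.negSucc m) = 2 * m + 1 := rfl
    rw [this, show (2 * m + 1) * (2 * m + 1 + 1) = 2 * ((2 * m + 1) * (m + 1)) by ring,
      Nat.mul_div_cancel_left _ two_pos, Int.negSucc_eq]
    push_cast
    ring

/-- In terms of `x = 4 * j + 1` and `y = 4 * k + 1`, this is the involution
`(x, y) ↦ ((x - 3 * y) / 2, -(x + y) / 2)` preserving `x ^ 2 + 3 * y ^ 2`. -/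
def reflect (p : ℤ × ℤ) : ℤ × ℤ := ((p.1 - 3 * p.2 - 1) / 2, -(p.1 + p.2 + 1) / 2)

/-- The quadratic polynomial counting one triangular number plus three times another. -/
def form (p : ℤ × ℤ) : ℤ := 2 * p.1 ^ 2 + p.1 + 3 * (2 * p.2 ^ 2 + p.2)

lemma reflect_spec {p : ℤ × ℤ} {n : ℤ} (h : form p = 4 * n + 3) :
    form (reflect p) = 4 * n + 3 ∧ reflect (reflect p) = p ∧ reflect p ≠ p := by
  obtain ⟨j, k⟩ := p
  simp only [form, reflect] at h ⊢
  obtain ⟨t, ht⟩ : ∃ t, j = 2 * t + 1 + k := ⟨(j - k - 1) / 2, by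
    generalize j ^ 2 = u at h
    generalize k ^ 2 = v at h
    omega⟩
  subst ht
  have e₁ : (2 * t + 1 + k - 3 * k - 1) / 2 = t - k := by omega
  have e₂ : -(2 * t + 1 + k + k + 1) / 2 = -t - k - 1 := by omega
  rw [e₁, e₂]
  refine ⟨by linear_combination h, by ext <;> simp only <;> omega, fun h' ↦ ?_⟩
  rw [Prod.mk.injEq] at h'
  obtain rfl : t = -2 * k - 1 := by omega
  ring_nf at h
  have hk : Even (k * (k + 1)) := Int.even_mul_succ_self k
  obtain ⟨r, hr⟩ := hk
  have hr' : k ^ 2 = 2 * r - k := by linear_combination hr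
  rw [hr'] at h
  omega

lemma coeff_triangularSeries_mul (n : ℕ) :
    coeff (4 * n + 3) (triangularSeries 1 * triangularSeries 3) = 0 := by
  set B := 4 * n + 4 with hB
  have h : coeff (4 * n + 3) (triangularSeries 1 * triangularSeries 3) =
      coeff (4 * n + 3) ((∑ k ∈ range B, (X ^ 1 : (ZMod 2)⟦X⟧) ^ (k * (k + 1) / 2)) *
        ∑ k ∈ range B, (X ^ 3) ^ (k * (k + 1) / 2)) := by
    rw [coeff_mul, coeff_mul]
    refine sum_congr rfl fun p hp ↦ ?_
    rw [HasAntidiagonal.mem_antidiagonal] at hp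
    rw [coeff_triangularSeries one_pos (show p.1 < B by omega),
      coeff_triangularSeries three_pos (show p.2 < B by omega)]
  rw [h, sum_mul_sum, ← sum_product', map_sum]
  simp_rw [← pow_mul, ← pow_add, coeff_X_pow]
  rw [← sum_filter]
  set e : ℕ × ℕ ≃ ℤ × ℤ := Equiv.intEquivNat.symm.prodCongr Equiv.intEquivNat.symm
  have hmem (p : ℕ × ℕ) : p ∈ (range B ×ˢ range B).filter (fun p ↦ 4 * n + 3 =
      1 * (p.1 * (p.1 + 1) / 2) + 3 * (p.2 * (p.2 + 1) / 2)) ↔ form (e p) = 4 * (n : ℤ) + 3 := by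
    have h₁ := triangle_eq p.1
    have h₂ := triangle_eq p.2
    have h₃ := le_triangle p.1
    have h₄ := le_triangle p.2
    have h₅ : form (e p) = ((p.1 * (p.1 + 1) / 2 : ℕ) : ℤ) + 3 * (p.2 * (p.2 + 1) / 2 : ℕ) := by
      rw [h₁, h₂]
      rfl
    rw [h₅, mem_filter, mem_product, mem_range, mem_range]
    omega
  refine sum_involution (fun p _ ↦ e.symm (reflect (e p))) (fun _ _ ↦ by decide)
    (fun p hp _ h ↦ ?_) (fun p hp ↦ ?_) (fun p hp ↦ ?_)
  · exact (reflect_spec ((hmem p).mp hp)).2.2 (by rwa [Equiv.symm_apply_eq] at h)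
  · rw [hmem, Equiv.apply_symm_apply]
    exact (reflect_spec ((hmem p).mp hp)).1
  · rw [Equiv.apply_symm_apply, (reflect_spec ((hmem p).mp hp)).2.1, Equiv.symm_apply_apply]

lemma coeff_eulerProd_mul_of_not_dvd {N : ℕ} (h : ¬ 4 ∣ N) :
    coeff N (eulerProd 4 * eulerProd 12) = 0 := by
  rw [coeff_mul]
  refine sum_eq_zero fun p hp ↦ ?_
  rw [HasAntidiagonal.mem_antidiagonal] at hp
  by_cases h₁ : 4 ∣ p.1
  · rw [coeff_eulerProd_of_not_dvd (N := p.2) (by norm_num) (by omega), mul_zero]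
  · rw [coeff_eulerProd_of_not_dvd (by norm_num) h₁, zero_mul]

lemma coeff_genSeries_four_mul_add_three (n : ℕ) : coeff (4 * n + 3) genSeries = 0 := by
  induction n using Nat.strong_induction_on with
  | _ n ih =>
    have h := coeff_triangularSeries_mul n
    rw [← genSeries_mul_eulerProd, coeff_mul, sum_eq_single (4 * n + 3, 0)] at h
    · simpa [coeff_mul, coeff_zero_eulerProd] using h
    · intro p hp hne
      rw [HasAntidiagonal.mem_antidiagonal] at hp
      by_cases h4 : 4 ∣ p.2
      · have h0 : p.2 ≠ 0 := fun h0 ↦ hne (Prod.ext (by simp; omega) h0)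
        have : p.1 = 4 * ((p.1 - 3) / 4) + 3 := by omega
        rw [this, ih _ (by omega), zero_mul]
      · rw [coeff_eulerProd_mul_of_not_dvd h4, mul_zero]
    · simp

end OddAtMostTwice

theorem a_four_n_add_three_even (n : ℕ) : Even (a (4 * n + 3)) := by
  rw [← ZMod.natCast_eq_zero_iff_even, ← OddAtMostTwice.coeff_genSeries]
  exact OddAtMostTwice.coeff_genSeries_four_mul_add_three n
end
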